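/- arXiv:2512.10901 — 10 statements merged into one kernel-verified Lean document; each statement's English description precedes it below -/
import Mathlib

section
/- Let n ≥ 1, let φ : V → ℝ be differentiable at y ∈ V, and define Λ : V → V by Λ(x) = exp(φ(x)) • x. If η(y,y) = 0 and u, v ∈ V satisfy η(y,u) = 0 and η(y,v) = 0, then η((fderiv ℝ Λ y) u, (fderiv ℝ Λ y) v) = exp(2 φ(y)) * η(u,v). (This is the key computation behind Property 3 of the paper: a dilation Λ : y ↦ e^φ y of the ambient space along the null cone induces a conformal map with Weyl factor e^{2φ} between the embedded spaces X_{f₁} and X_{f₂}.) -/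
/-- The ambient bilinear form of signature (+,-,…,-,+) on `ℝ^{n+2}`. -/
noncomputable def eta (n : ℕ) (x y : Fin (n + 2) → ℝ) : ℝ :=
  x 0 * y 0
    - ∑ i : Fin n, x ⟨i.val + 1, by have := i.isLt; omega⟩ * y ⟨i.val + 1, by have := i.isLt; omega⟩
    + x ⟨n + 1, by omega⟩ * y ⟨n + 1, by omega⟩

theorem eta_combo (n : ℕ) (a b c : ℝ) (y u v : Fin (n + 2) → ℝ) :
    eta n (a • u + b • y) (a • v + c • y)
      = a * a * eta n u v + a * c * eta n y u + a * b * eta n y v + b * c * eta n y y := by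
  have hs : ∀ f : Fin n → Fin (n + 2),
      ∑ i, (a • u + b • y) (f i) * (a • v + c • y) (f i)
        = a * a * ∑ i, u (f i) * v (f i) + a * c * ∑ i, y (f i) * u (f i)
          + a * b * ∑ i, y (f i) * v (f i) + b * c * ∑ i, y (f i) * y (f i) := by
    intro f
    simp only [Finset.mul_sum, ← Finset.sum_add_distrib]
    refine Finset.sum_congr rfl fun i _ => ?_
    simp only [Pi.add_apply, Pi.smul_apply, smul_eq_mul]
    ring
  unfold eta
  rw [hs (fun i => ⟨i.val + 1, by have := i.isLt; omega⟩)]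
  simp only [Pi.add_apply, Pi.smul_apply, smul_eq_mul]
  ring

/-- The dilation `Λ : x ↦ e^{φ(x)} x` of the ambient space acts conformally with
Weyl factor `e^{2φ(y)}` on vectors tangent to the null cone. -/
theorem stmt_1 (n : ℕ) (hn : 1 ≤ n) (φ : (Fin (n + 2) → ℝ) → ℝ)
    (y : Fin (n + 2) → ℝ) (hφ : DifferentiableAt ℝ φ y)
    (hyy : eta n y y = 0)
    (u v : Fin (n + 2) → ℝ) (hyu : eta n y u = 0) (hyv : eta n y v = 0) :
    eta n (fderiv ℝ (fun x => Real.exp (φ x) • x) y u)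
          (fderiv ℝ (fun x => Real.exp (φ x) • x) y v)
      = Real.exp (2 * φ y) * eta n u v := by
  have hd : ∀ w, fderiv ℝ (fun x => Real.exp (φ x) • x) y w
      = Real.exp (φ y) • w + (Real.exp (φ y) * fderiv ℝ φ y w) • y := by
    intro w
    have h := (hφ.hasFDerivAt.exp).smul (hasFDerivAt_id (𝕜 := ℝ) y)
    have h' : fderiv ℝ (fun x => Real.exp (φ x) • x) y = _ := h.fderiv
    rw [h']
    simp
  rw [hd, hd, eta_combo, hyy, hyu, hyv, two_mul, Real.exp_add]
  ring
end

section
/- Let n ≥ 1, let g : V →ₗ[ℝ] V be a linear map preserving η (η(g x, g x') = η(x, x') for all x, x'), and let f : V → ℝ be differentiable at g y with f(g y) ≠ 0. Define h : V → V by h(x) = (f(g x))⁻¹ • (g x). If η(y,y) = 0 and u, v ∈ V satisfy η(y,u) = 0 and η(y,v) = 0, then η((fderiv ℝ h y) u, (fderiv ℝ h y) v) = (f(g y))⁻² * η(u,v). (This is the conformal-action computation of Property 3: an element g of SO(2,n), acting on X_f by g_f(y) = g·y / f(g·y), acts as a conformal transformation with conformal factor 1/f(g·y)².) -/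
theorem eta_symm_aux (n : ℕ) (x y : Fin (n + 2) → ℝ) : eta n x y = eta n y x := by
  simp only [eta, mul_comm]

theorem eta_lin_aux (n : ℕ) (a b : ℝ) (x y z : Fin (n + 2) → ℝ) :
    eta n (a • x + b • y) z = a * eta n x z + b * eta n y z := by
  have h : ∀ p q r : ℝ, (a * p + b * q) * r = a * (p * r) + b * (q * r) := by
    intro p q r; ring
  simp only [eta, Pi.add_apply, Pi.smul_apply, smul_eq_mul, h, Finset.sum_add_distrib,
    ← Finset.mul_sum]
  ring

/-- Property 3 (conformal action): an `η`-preserving linear map `g` acting by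
`h(x) = g·x / f(g·x)` acts as a conformal transformation with conformal factor
`1 / f(g·y)²` on vectors tangent to the null cone. -/
theorem stmt_2 (n : ℕ) (hn : 1 ≤ n)
    (g : (Fin (n + 2) → ℝ) →ₗ[ℝ] (Fin (n + 2) → ℝ))
    (hg : ∀ x x', eta n (g x) (g x') = eta n x x')
    (f : (Fin (n + 2) → ℝ) → ℝ) (y : Fin (n + 2) → ℝ)
    (hf : DifferentiableAt ℝ f (g y)) (hfy : f (g y) ≠ 0)
    (hyy : eta n y y = 0)
    (u v : Fin (n + 2) → ℝ) (hyu : eta n y u = 0) (hyv : eta n y v = 0) :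
    eta n (fderiv ℝ (fun x => (f (g x))⁻¹ • (g x)) y u)
          (fderiv ℝ (fun x => (f (g x))⁻¹ • (g x)) y v)
      = (f (g y) ^ 2)⁻¹ * eta n u v := by
  have hG : HasFDerivAt (fun x => g x) (LinearMap.toContinuousLinearMap g) y :=
    (LinearMap.toContinuousLinearMap g).hasFDerivAt
  have hF : DifferentiableAt ℝ (fun x => (f (g x))⁻¹) y :=
    (DifferentiableAt.comp y hf hG.differentiableAt).inv hfy
  have key : ∀ w, fderiv ℝ (fun x => (f (g x))⁻¹ • (g x)) y w
      = (f (g y))⁻¹ • g w + (fderiv ℝ (fun x => (f (g x))⁻¹) y w) • g y := by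
    intro w
    rw [(hF.hasFDerivAt.fun_smul hG).fderiv]
    simp
  rw [key, key, eta_lin_aux, eta_symm_aux n (g u), eta_symm_aux n (g y), eta_lin_aux, eta_lin_aux]
  simp only [hg]
  rw [eta_symm_aux n v y, eta_symm_aux n v u, hyy, hyu, hyv]
  field_simp
  ring
end

section
/- Let n ≥ 1 and let a : ℝ → ℝ be differentiable. With Y the k = 0 FLRW embedding, for every ξ : Fin n → ℝ: (i) η(Y ξ, Y ξ) = 0 (the image lies on the null cone of V); (ii) for all u, v : Fin n → ℝ, η((fderiv ℝ Y ξ) u, (fderiv ℝ Y ξ) v) = (a (ξ 0))^2 * q(u,v). (Property 4 of the paper, case k = 0: the formulas yield an embedding into ℝ^{n+2} of the spatially flat FLRW space, with induced metric a(t)²·(Minkowski metric) in conformal time t = ξ⁰.) -/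
/-- The Minkowski bilinear form on `ℝ^n` (signature (+,-,…,-), `n ≥ 1`). -/
noncomputable def qMink (n : ℕ) (hn : 1 ≤ n) (u v : Fin n → ℝ) : ℝ :=
  u ⟨0, hn⟩ * v ⟨0, hn⟩
    - ∑ i : Fin (n - 1),
        u ⟨i.val + 1, by have := i.isLt; omega⟩ * v ⟨i.val + 1, by have := i.isLt; omega⟩

/-- The k = 0 FLRW embedding into `ℝ^{n+2}`. -/
noncomputable def FLRW0 (n : ℕ) (hn : 1 ≤ n) (a : ℝ → ℝ) (ξ : Fin n → ℝ) :
    Fin (n + 2) → ℝ :=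
  fun μ =>
    if h : (μ : ℕ) < n then a (ξ ⟨0, hn⟩) * ξ ⟨(μ : ℕ), h⟩
    else if (μ : ℕ) = n then (1 / 2) * a (ξ ⟨0, hn⟩) * (1 + qMink n hn ξ ξ)
    else (1 / 2) * a (ξ ⟨0, hn⟩) * (1 - qMink n hn ξ ξ)

theorem qMink_lin (n : ℕ) (hn : 1 ≤ n) (c d e f : ℝ) (x y z w : Fin n → ℝ) :
    qMink n hn (fun i => c * x i + d * y i) (fun i => e * z i + f * w i)
      = c * e * qMink n hn x z + c * f * qMink n hn x w
        + d * e * qMink n hn y z + d * f * qMink n hn y w := by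
  unfold qMink
  simp only [mul_sub, Finset.mul_sum]
  have key : ∀ (p q r s : Fin (n - 1) → ℝ) (A B C D E : ℝ) (t : Fin (n - 1) → ℝ),
      (∀ i, t i = p i + q i + r i + s i) → E = A + B + C + D →
      E - ∑ i, t i = A - ∑ i, p i + (B - ∑ i, q i) + (C - ∑ i, r i) + (D - ∑ i, s i) := by
    intro p q r s A B C D E t h h'
    simp only [h, h', Finset.sum_add_distrib]
    ring
  apply key
  · intro i
    ring
  · ring

theorem qMink_comm' (n : ℕ) (hn : 1 ≤ n) (x y : Fin n → ℝ) :
    qMink n hn x y = qMink n hn y x := by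
  unfold qMink
  simp only [mul_comm]

theorem eta_eq (n : ℕ) (hn : 1 ≤ n) (x y : Fin (n + 2) → ℝ) :
    eta n x y = qMink n hn (fun i => x ⟨i.val, by omega⟩) (fun i => y ⟨i.val, by omega⟩)
      - x ⟨n, by omega⟩ * y ⟨n, by omega⟩ + x ⟨n + 1, by omega⟩ * y ⟨n + 1, by omega⟩ := by
  obtain ⟨m, rfl⟩ : ∃ m, n = m + 1 := ⟨n - 1, by omega⟩
  unfold eta qMink
  rw [Fin.sum_univ_castSucc]
  have key : ∀ A S L B : ℝ, A - (S + L) + B = A - S - L + B := by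
    intros
    ring
  exact key _ _ _ _

theorem FLRW0_diff (n : ℕ) (hn : 1 ≤ n) (a : ℝ → ℝ) (ha : Differentiable ℝ a) :
    Differentiable ℝ (FLRW0 n hn a) := by
  rw [differentiable_pi]
  intro μ
  unfold FLRW0 qMink
  split_ifs <;> fun_prop

theorem FLRW0_line (n : ℕ) (hn : 1 ≤ n) (a : ℝ → ℝ) (ha : Differentiable ℝ a)
    (ξ u : Fin n → ℝ) (μ : Fin (n + 2)) :
    HasDerivAt (fun t : ℝ => FLRW0 n hn a (fun i => 1 * ξ i + t * u i) μ)
      (fderiv ℝ (FLRW0 n hn a) ξ u μ) 0 := by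
  have h1 : HasDerivAt (fun t : ℝ => (fun i => 1 * ξ i + t * u i : Fin n → ℝ)) u 0 := by
    rw [hasDerivAt_pi]
    intro i
    simpa using ((hasDerivAt_id (0 : ℝ)).mul_const (u i)).const_add (1 * ξ i)
  have h2 : HasFDerivAt (FLRW0 n hn a) (fderiv ℝ (FLRW0 n hn a) ξ)
      ((fun t : ℝ => (fun i => 1 * ξ i + t * u i : Fin n → ℝ)) 0) := by
    have : ((fun t : ℝ => (fun i => 1 * ξ i + t * u i : Fin n → ℝ)) 0) = ξ := by
      funext i
      simp
    rw [this]
    exact (FLRW0_diff n hn a ha ξ).hasFDerivAt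
  exact (hasDerivAt_pi.1 (h2.comp_hasDerivAt (0 : ℝ) h1)) μ

theorem a_line (a : ℝ → ℝ) (ha : Differentiable ℝ a) (x w : ℝ) :
    HasDerivAt (fun t : ℝ => a (1 * x + t * w)) (deriv a x * w) 0 := by
  have h1 : HasDerivAt (fun t : ℝ => 1 * x + t * w) w 0 := by
    simpa using ((hasDerivAt_id (0 : ℝ)).mul_const w).const_add (1 * x)
  have h2 : HasDerivAt a (deriv a x) ((fun t : ℝ => 1 * x + t * w) 0) := by
    simpa using (ha x).hasDerivAt
  exact h2.comp (0 : ℝ) h1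

theorem q_line (n : ℕ) (hn : 1 ≤ n) (ξ u : Fin n → ℝ) :
    HasDerivAt (fun t : ℝ => qMink n hn (fun i => 1 * ξ i + t * u i)
      (fun i => 1 * ξ i + t * u i)) (2 * qMink n hn ξ u) 0 := by
  simp only [qMink_lin]
  rw [qMink_comm' n hn u ξ]
  have hi := hasDerivAt_id (0 : ℝ)
  have := (((hi.mul_const (2 * qMink n hn ξ u)).add
    ((hi.mul hi).mul_const (qMink n hn u u))).const_add (qMink n hn ξ ξ))
  refine (this.congr_deriv (by simp)).congr_of_eventuallyEq (Filter.Eventually.of_forall ?_)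
  intro t
  simp
  ring

theorem dFLRW0_lt (n : ℕ) (hn : 1 ≤ n) (a : ℝ → ℝ) (ha : Differentiable ℝ a)
    (ξ u : Fin n → ℝ) (i : Fin n) :
    fderiv ℝ (FLRW0 n hn a) ξ u ⟨i.val, by omega⟩
      = deriv a (ξ ⟨0, hn⟩) * u ⟨0, hn⟩ * ξ i + a (ξ ⟨0, hn⟩) * u i := by
  have h := FLRW0_line n hn a ha ξ u ⟨i.val, by omega⟩
  have hl : HasDerivAt (fun t : ℝ => 1 * ξ i + t * u i) (u i) 0 := by
    simpa using ((hasDerivAt_id (0 : ℝ)).mul_const (u i)).const_add (1 * ξ i)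
  have h' := (a_line a ha (ξ ⟨0, hn⟩) (u ⟨0, hn⟩)).mul hl
  have e : (fun t : ℝ => FLRW0 n hn a (fun i => 1 * ξ i + t * u i) ⟨i.val, by omega⟩)
      = (fun t : ℝ => a (1 * ξ ⟨0, hn⟩ + t * u ⟨0, hn⟩)) * (fun t : ℝ => 1 * ξ i + t * u i) := by
    funext t
    simp [FLRW0]
  rw [e] at h
  rw [h.unique h']
  simp

theorem dFLRW0_n (n : ℕ) (hn : 1 ≤ n) (a : ℝ → ℝ) (ha : Differentiable ℝ a)
    (ξ u : Fin n → ℝ) :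
    fderiv ℝ (FLRW0 n hn a) ξ u ⟨n, by omega⟩
      = 1 / 2 * (deriv a (ξ ⟨0, hn⟩) * u ⟨0, hn⟩) * (1 + qMink n hn ξ ξ)
        + a (ξ ⟨0, hn⟩) * qMink n hn ξ u := by
  have h := FLRW0_line n hn a ha ξ u ⟨n, by omega⟩
  have h' := ((a_line a ha (ξ ⟨0, hn⟩) (u ⟨0, hn⟩)).const_mul (1 / 2)).mul
    ((q_line n hn ξ u).const_add 1)
  have e : (fun t : ℝ => FLRW0 n hn a (fun i => 1 * ξ i + t * u i) ⟨n, by omega⟩)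
      = (fun t : ℝ => 1 / 2 * a (1 * ξ ⟨0, hn⟩ + t * u ⟨0, hn⟩)) *
        (fun t : ℝ => 1 + qMink n hn (fun i => 1 * ξ i + t * u i)
          (fun i => 1 * ξ i + t * u i)) := by
    funext t
    simp [FLRW0]
  rw [e] at h
  rw [h.unique h']
  simp
  ring

theorem dFLRW0_n1 (n : ℕ) (hn : 1 ≤ n) (a : ℝ → ℝ) (ha : Differentiable ℝ a)
    (ξ u : Fin n → ℝ) :
    fderiv ℝ (FLRW0 n hn a) ξ u ⟨n + 1, by omega⟩
      = 1 / 2 * (deriv a (ξ ⟨0, hn⟩) * u ⟨0, hn⟩) * (1 - qMink n hn ξ ξ)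
        - a (ξ ⟨0, hn⟩) * qMink n hn ξ u := by
  have h := FLRW0_line n hn a ha ξ u ⟨n + 1, by omega⟩
  have h' := ((a_line a ha (ξ ⟨0, hn⟩) (u ⟨0, hn⟩)).const_mul (1 / 2)).mul
    ((q_line n hn ξ u).const_sub 1)
  have e : (fun t : ℝ => FLRW0 n hn a (fun i => 1 * ξ i + t * u i) ⟨n + 1, by omega⟩)
      = (fun t : ℝ => 1 / 2 * a (1 * ξ ⟨0, hn⟩ + t * u ⟨0, hn⟩)) *
        (fun t : ℝ => 1 - qMink n hn (fun i => 1 * ξ i + t * u i)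
          (fun i => 1 * ξ i + t * u i)) := by
    funext t
    simp [FLRW0]
  rw [e] at h
  rw [h.unique h']
  simp
  ring

/-- Property 4, case k = 0: the embedding lands on the null cone, and the induced
metric is `a(ξ⁰)²` times the Minkowski metric. -/
theorem stmt_3 (n : ℕ) (hn : 1 ≤ n) (a : ℝ → ℝ) (ha : Differentiable ℝ a)
    (ξ : Fin n → ℝ) :
    eta n (FLRW0 n hn a ξ) (FLRW0 n hn a ξ) = 0 ∧
    ∀ u v : Fin n → ℝ,
      eta n (fderiv ℝ (FLRW0 n hn a) ξ u) (fderiv ℝ (FLRW0 n hn a) ξ v)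
        = (a (ξ ⟨0, hn⟩)) ^ 2 * qMink n hn u v := by
  constructor
  · rw [eta_eq n hn]
    have h1 : (fun i : Fin n => FLRW0 n hn a ξ ⟨i.val, by omega⟩)
        = fun i => a (ξ ⟨0, hn⟩) * ξ i + 0 * ξ i := by
      funext i
      simp [FLRW0]
    rw [h1, qMink_lin]
    simp [FLRW0]
    ring
  · intro u v
    rw [eta_eq n hn]
    simp only [dFLRW0_lt n hn a ha, dFLRW0_n n hn a ha, dFLRW0_n1 n hn a ha, qMink_lin]
    rw [qMink_comm' n hn u ξ]
    ring
end

section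
/- Let n ≥ 2 and let a : ℝ → ℝ be differentiable. With Y the k = -1 FLRW embedding, for every (t,χ,ω) with ∑_i (ω i)^2 = 1: (i) η(Y(t,χ,ω), Y(t,χ,ω)) = 0; (ii) for all tangent vectors (s,x,w) and (s',x',w') in ℝ × ℝ × (Fin (n-1) → ℝ) with ω·w = 0 and ω·w' = 0, η((fderiv ℝ Y (t,χ,ω)) (s,x,w), (fderiv ℝ Y (t,χ,ω)) (s',x',w')) = (a t)^2 * (s*s' - x*x' - (sinh χ)^2 * (w·w')). (Property 4 of the paper, case k = -1: the formulas yield an embedding into ℝ^{n+2} of the open FLRW space, with induced metric a(t)²·[dt² - dχ² - sinh²χ · (metric of the unit (n-2)-sphere)].) -/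
/-- Euclidean dot product. -/
noncomputable def dot {m : ℕ} (u v : Fin m → ℝ) : ℝ := ∑ i, u i * v i

/-- The k = -1 FLRW embedding into `ℝ^{n+2}`:
`Y(t,χ,ω) 0 = a t * cosh χ`, `Y(t,χ,ω) i = a t * sinh χ * ω i` for `1 ≤ i ≤ n-1`,
`Y(t,χ,ω) n = a t * cosh t`, `Y(t,χ,ω) (n+1) = a t * sinh t`. -/
noncomputable def FLRWm1 (n : ℕ) (a : ℝ → ℝ) (p : ℝ × ℝ × (Fin (n - 1) → ℝ)) :
    Fin (n + 2) → ℝ :=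
  fun μ =>
    if h0 : (μ : ℕ) = 0 then a p.1 * Real.cosh p.2.1
    else if h1 : (μ : ℕ) < n then
      a p.1 * Real.sinh p.2.1 * p.2.2 ⟨(μ : ℕ) - 1, by omega⟩
    else if (μ : ℕ) = n then a p.1 * Real.cosh p.1
    else a p.1 * Real.sinh p.1

theorem eta_succ (m : ℕ) (x y : Fin (m + 1 + 2) → ℝ) :
    eta (m + 1) x y = x 0 * y 0
      - ((∑ i : Fin m, x ⟨i.val + 1, by omega⟩ * y ⟨i.val + 1, by omega⟩)
        + x ⟨m + 1, by omega⟩ * y ⟨m + 1, by omega⟩)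
      + x ⟨m + 2, by omega⟩ * y ⟨m + 2, by omega⟩ := by
  unfold eta
  rw [Fin.sum_univ_castSucc]
  rfl

theorem FLRW_zero (m : ℕ) (a : ℝ → ℝ) (p : ℝ × ℝ × (Fin m → ℝ)) :
    FLRWm1 (m + 1) a p 0 = a p.1 * Real.cosh p.2.1 := by
  simp [FLRWm1]

theorem FLRW_mid (m : ℕ) (a : ℝ → ℝ) (p : ℝ × ℝ × (Fin m → ℝ)) (i : Fin m) :
    FLRWm1 (m + 1) a p ⟨i.val + 1, by omega⟩ = a p.1 * Real.sinh p.2.1 * p.2.2 i := by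
  simp [FLRWm1]

theorem FLRW_n (m : ℕ) (a : ℝ → ℝ) (p : ℝ × ℝ × (Fin m → ℝ)) :
    FLRWm1 (m + 1) a p ⟨m + 1, by omega⟩ = a p.1 * Real.cosh p.1 := by
  simp [FLRWm1]

theorem FLRW_last (m : ℕ) (a : ℝ → ℝ) (p : ℝ × ℝ × (Fin m → ℝ)) :
    FLRWm1 (m + 1) a p ⟨m + 2, by omega⟩ = a p.1 * Real.sinh p.1 := by
  simp [FLRWm1]

theorem FLRW_diff (m : ℕ) (a : ℝ → ℝ) (ha : Differentiable ℝ a) :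
    Differentiable ℝ (fun p : ℝ × ℝ × (Fin m → ℝ) => FLRWm1 (m + 1) a p) := by
  rw [differentiable_pi]
  intro μ
  unfold FLRWm1
  split_ifs <;> fun_prop

theorem FLRW_comp (m : ℕ) (a : ℝ → ℝ) (ha : Differentiable ℝ a)
    (p v : ℝ × ℝ × (Fin m → ℝ)) (μ : Fin (m + 1 + 2)) (c : ℝ)
    (h : HasDerivAt (fun r : ℝ => FLRWm1 (m + 1) a (p + r • v) μ) c 0) :
    fderiv ℝ (fun p : ℝ × ℝ × (Fin m → ℝ) => FLRWm1 (m + 1) a p) p v μ = c := by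
  have h1 := ((FLRW_diff m a ha) p).hasFDerivAt.hasLineDerivAt v
  have h2 := (hasDerivAt_pi.1 h1) μ
  exact h2.unique h

theorem mul_lam {f g : ℝ → ℝ} {f' g' : ℝ} (hf : HasDerivAt f f' 0) (hg : HasDerivAt g g' 0) :
    HasDerivAt (fun r => f r * g r) (f' * g 0 + f 0 * g') 0 := hf.mul hg

theorem main_aux (m : ℕ) (a : ℝ → ℝ) (ha : Differentiable ℝ a)
    (t χ : ℝ) (ω : Fin m → ℝ) (hω : ∑ i, (ω i) ^ 2 = 1) :
    eta (m + 1) (FLRWm1 (m + 1) a (t, χ, ω)) (FLRWm1 (m + 1) a (t, χ, ω)) = 0 ∧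
    ∀ (s x : ℝ) (w : Fin m → ℝ) (s' x' : ℝ) (w' : Fin m → ℝ),
      dot ω w = 0 → dot ω w' = 0 →
      eta (m + 1) (fderiv ℝ (fun p : ℝ × ℝ × (Fin m → ℝ) => FLRWm1 (m + 1) a p) (t, χ, ω) (s, x, w))
            (fderiv ℝ (fun p : ℝ × ℝ × (Fin m → ℝ) => FLRWm1 (m + 1) a p) (t, χ, ω) (s', x', w'))
        = (a t) ^ 2 * (s * s' - x * x' - (Real.sinh χ) ^ 2 * dot w w') := by
  have ct := Real.cosh_sq t
  have cx := Real.cosh_sq χ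
  constructor
  · rw [eta_succ, FLRW_zero, FLRW_n, FLRW_last]
    simp only [FLRW_mid]
    have : ∑ i, a t * Real.sinh χ * ω i * (a t * Real.sinh χ * ω i)
        = (a t * Real.sinh χ) ^ 2 * ∑ i, (ω i) ^ 2 := by
      rw [Finset.mul_sum]; exact Finset.sum_congr rfl fun i _ => by ring
    rw [this, hω]
    linear_combination (a t) ^ 2 * (cx - ct)
  · intro s x w s' x' w' hw hw'
    have hl : ∀ u c : ℝ, HasDerivAt (fun r : ℝ => u + r * c) c 0 := fun u c => by
      simpa using ((hasDerivAt_id (0 : ℝ)).mul_const c).const_add u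
    have hA : ∀ s : ℝ, HasDerivAt (fun r : ℝ => a (t + r * s)) (deriv a t * s) 0 := fun s => by
      have h := (ha (t + 0 * s)).hasDerivAt.comp (0 : ℝ) (hl t s)
      have h' : HasDerivAt (fun r : ℝ => a (t + r * s)) (deriv a (t + 0 * s) * s) 0 := h
      simpa using h'
    have hC : ∀ u s : ℝ, HasDerivAt (fun r : ℝ => Real.cosh (u + r * s)) (Real.sinh u * s) 0 :=
      fun u s => by simpa using (hl u s).cosh
    have hS : ∀ u s : ℝ, HasDerivAt (fun r : ℝ => Real.sinh (u + r * s)) (Real.cosh u * s) 0 :=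
      fun u s => by simpa using (hl u s).sinh
    have e0 : ∀ s x w, fderiv ℝ (fun p : ℝ × ℝ × (Fin m → ℝ) => FLRWm1 (m + 1) a p) (t, χ, ω)
        (s, x, w) 0 = deriv a t * s * Real.cosh χ + a t * (Real.sinh χ * x) := fun s x w => by
      apply FLRW_comp m a ha
      simp only [FLRW_zero]
      simpa using mul_lam (hA s) (hC χ x)
    have en : ∀ s x w, fderiv ℝ (fun p : ℝ × ℝ × (Fin m → ℝ) => FLRWm1 (m + 1) a p) (t, χ, ω)
        (s, x, w) ⟨m + 1, by omega⟩
          = deriv a t * s * Real.cosh t + a t * (Real.sinh t * s) := fun s x w => by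
      apply FLRW_comp m a ha
      simp only [FLRW_n]
      simpa using mul_lam (hA s) (hC t s)
    have el : ∀ s x w, fderiv ℝ (fun p : ℝ × ℝ × (Fin m → ℝ) => FLRWm1 (m + 1) a p) (t, χ, ω)
        (s, x, w) ⟨m + 2, by omega⟩
          = deriv a t * s * Real.sinh t + a t * (Real.cosh t * s) := fun s x w => by
      apply FLRW_comp m a ha
      simp only [FLRW_last]
      simpa using mul_lam (hA s) (hS t s)
    have em : ∀ s x w, ∀ i : Fin m,
        fderiv ℝ (fun p : ℝ × ℝ × (Fin m → ℝ) => FLRWm1 (m + 1) a p) (t, χ, ω)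
        (s, x, w) ⟨i.val + 1, by omega⟩
          = (deriv a t * s * Real.sinh χ + a t * (Real.cosh χ * x)) * ω i
            + a t * Real.sinh χ * w i := fun s x w i => by
      apply FLRW_comp m a ha
      simp only [FLRW_mid]
      simpa using mul_lam (mul_lam (hA s) (hS χ x)) (hl (ω i) (w i))
    rw [eta_succ, e0, e0, en, en, el, el]
    simp only [em]
    have key : ∀ A B C : ℝ, ∑ i, (A * ω i + C * w i) * (B * ω i + C * w' i)
        = A * B + C ^ 2 * dot w w' := fun A B C => by
      have : ∑ i, (A * ω i + C * w i) * (B * ω i + C * w' i)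
          = A * B * ∑ i, (ω i) ^ 2 + A * C * dot ω w' + B * C * dot ω w + C ^ 2 * dot w w' := by
        simp only [dot, Finset.mul_sum, ← Finset.sum_add_distrib]
        exact Finset.sum_congr rfl fun i _ => by ring
      rw [this, hω, hw, hw']; ring
    rw [key]
    linear_combination (deriv a t ^ 2 * s * s' - a t ^ 2 * x * x') * cx
      + (a t ^ 2 * s * s' - deriv a t ^ 2 * s * s') * ct


/-- Property 4, case k = -1: the embedding lands on the null cone, and the induced
metric is `a(t)²·[dt² - dχ² - sinh²χ · (metric of the unit (n-2)-sphere)]`. -/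
theorem stmt_4 (n : ℕ) (hn : 2 ≤ n) (a : ℝ → ℝ) (ha : Differentiable ℝ a)
    (t χ : ℝ) (ω : Fin (n - 1) → ℝ) (hω : ∑ i, (ω i) ^ 2 = 1) :
    eta n (FLRWm1 n a (t, χ, ω)) (FLRWm1 n a (t, χ, ω)) = 0 ∧
    ∀ (s x : ℝ) (w : Fin (n - 1) → ℝ) (s' x' : ℝ) (w' : Fin (n - 1) → ℝ),
      dot ω w = 0 → dot ω w' = 0 →
      eta n (fderiv ℝ (FLRWm1 n a) (t, χ, ω) (s, x, w))
            (fderiv ℝ (FLRWm1 n a) (t, χ, ω) (s', x', w'))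
        = (a t) ^ 2 * (s * s' - x * x' - (Real.sinh χ) ^ 2 * dot w w') := by
  obtain ⟨m, rfl⟩ : ∃ m, n = m + 1 := ⟨n - 1, by omega⟩
  exact main_aux m a ha t χ ω hω
end

section
/- Let n ≥ 2 and let a : ℝ → ℝ be differentiable. With Y the k = +1 FLRW embedding, for every (t,χ,ω) with ∑_i (ω i)^2 = 1: (i) η(Y(t,χ,ω), Y(t,χ,ω)) = 0; (ii) for all tangent vectors (s,x,w) and (s',x',w') in ℝ × ℝ × (Fin (n-1) → ℝ) with ω·w = 0 and ω·w' = 0, η((fderiv ℝ Y (t,χ,ω)) (s,x,w), (fderiv ℝ Y (t,χ,ω)) (s',x',w')) = (a t)^2 * (s*s' - x*x' - (sin χ)^2 * (w·w')). (Property 4 of the paper, case k = +1: the formulas yield an embedding into ℝ^{n+2} of the closed FLRW space, with induced metric a(t)²·[dt² - dχ² - sin²χ · (metric of the unit (n-2)-sphere)].) -/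
/-- The k = +1 FLRW embedding into `ℝ^{n+2}`:
`Y(t,χ,ω) 0 = a t * cos t`, `Y(t,χ,ω) i = a t * sin χ * ω i` for `1 ≤ i ≤ n-1`,
`Y(t,χ,ω) n = a t * cos χ`, `Y(t,χ,ω) (n+1) = a t * sin t`. -/
noncomputable def FLRWp1 (n : ℕ) (a : ℝ → ℝ) (p : ℝ × ℝ × (Fin (n - 1) → ℝ)) :
    Fin (n + 2) → ℝ :=
  fun μ =>
    if h0 : (μ : ℕ) = 0 then a p.1 * Real.cos p.1
    else if h1 : (μ : ℕ) < n then
      a p.1 * Real.sin p.2.1 * p.2.2 ⟨(μ : ℕ) - 1, by omega⟩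
    else if (μ : ℕ) = n then a p.1 * Real.cos p.2.1
    else a p.1 * Real.sin p.1

theorem FLRWp1_comp_aux (n : ℕ) (a : ℝ → ℝ) (ha : Differentiable ℝ a)
    (t χ : ℝ) (ω : Fin (n - 1) → ℝ) (s x : ℝ) (w : Fin (n - 1) → ℝ) (μ : Fin (n + 2)) :
    fderiv ℝ (FLRWp1 n a) (t, χ, ω) (s, x, w) μ =
    if h0 : (μ : ℕ) = 0 then (deriv a t * Real.cos t - a t * Real.sin t) * s
    else if h1 : (μ : ℕ) < n then
      (deriv a t * s * Real.sin χ + a t * Real.cos χ * x) * ω ⟨(μ : ℕ) - 1, by omega⟩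
        + a t * Real.sin χ * w ⟨(μ : ℕ) - 1, by omega⟩
    else if (μ : ℕ) = n then deriv a t * s * Real.cos χ - a t * Real.sin χ * x
    else (deriv a t * Real.sin t + a t * Real.cos t) * s := by
  have e1 : HasFDerivAt (fun p : ℝ × ℝ × (Fin (n - 1) → ℝ) => p.1)
      (ContinuousLinearMap.fst ℝ ℝ (ℝ × (Fin (n - 1) → ℝ))) (t, χ, ω) := hasFDerivAt_fst
  have e2 : HasFDerivAt (fun p : ℝ × ℝ × (Fin (n - 1) → ℝ) => p.2.1)
      ((ContinuousLinearMap.fst ℝ ℝ (Fin (n - 1) → ℝ)).comp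
        (ContinuousLinearMap.snd ℝ ℝ (ℝ × (Fin (n - 1) → ℝ)))) (t, χ, ω) :=
    ((ContinuousLinearMap.fst ℝ ℝ (Fin (n - 1) → ℝ)).comp
        (ContinuousLinearMap.snd ℝ ℝ (ℝ × (Fin (n - 1) → ℝ)))).hasFDerivAt
  have e3 : ∀ j, HasFDerivAt (fun p : ℝ × ℝ × (Fin (n - 1) → ℝ) => p.2.2 j)
      (((ContinuousLinearMap.proj j : (Fin (n - 1) → ℝ) →L[ℝ] ℝ).comp
        (ContinuousLinearMap.snd ℝ ℝ (Fin (n - 1) → ℝ))).comp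
        (ContinuousLinearMap.snd ℝ ℝ (ℝ × (Fin (n - 1) → ℝ)))) (t, χ, ω) := fun j =>
    (((ContinuousLinearMap.proj j : (Fin (n - 1) → ℝ) →L[ℝ] ℝ).comp
        (ContinuousLinearMap.snd ℝ ℝ (Fin (n - 1) → ℝ))).comp
        (ContinuousLinearMap.snd ℝ ℝ (ℝ × (Fin (n - 1) → ℝ)))).hasFDerivAt
  have ea := HasDerivAt.comp_hasFDerivAt (t, χ, ω) (ha t).hasDerivAt e1
  have d : ∀ ν, DifferentiableAt ℝ (fun p => FLRWp1 n a p ν) (t, χ, ω) := by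
    intro ν
    unfold FLRWp1
    split_ifs
    · exact (ea.mul e1.cos).differentiableAt
    · exact ((ea.mul e2.sin).mul (e3 _)).differentiableAt
    · exact (ea.mul e2.cos).differentiableAt
    · exact (ea.mul e1.sin).differentiableAt
  have k : fderiv ℝ (FLRWp1 n a) (t, χ, ω) (s, x, w) μ
      = fderiv ℝ (fun p => FLRWp1 n a p μ) (t, χ, ω) (s, x, w) := by
    rw [show fderiv ℝ (FLRWp1 n a) (t, χ, ω) = _ from
      (hasFDerivAt_pi.2 fun ν => (d ν).hasFDerivAt).fderiv]
    rfl
  rw [k]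
  unfold FLRWp1
  split_ifs
  · refine (congrArg (fun L => L (s, x, w)) (ea.mul e1.cos).fderiv).trans ?_
    simp; ring
  · refine (congrArg (fun L => L (s, x, w)) ((ea.mul e2.sin).mul (e3 _)).fderiv).trans ?_
    simp; ring
  · refine (congrArg (fun L => L (s, x, w)) (ea.mul e2.cos).fderiv).trans ?_
    simp; ring
  · refine (congrArg (fun L => L (s, x, w)) (ea.mul e1.sin).fderiv).trans ?_
    simp; ring

/-- Property 4, case k = +1: the embedding lands on the null cone, and the induced
metric is `a(t)²·[dt² - dχ² - sin²χ · (metric of the unit (n-2)-sphere)]`. -/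
theorem stmt_5 (n : ℕ) (hn : 2 ≤ n) (a : ℝ → ℝ) (ha : Differentiable ℝ a)
    (t χ : ℝ) (ω : Fin (n - 1) → ℝ) (hω : ∑ i, (ω i) ^ 2 = 1) :
    eta n (FLRWp1 n a (t, χ, ω)) (FLRWp1 n a (t, χ, ω)) = 0 ∧
    ∀ (s x : ℝ) (w : Fin (n - 1) → ℝ) (s' x' : ℝ) (w' : Fin (n - 1) → ℝ),
      dot ω w = 0 → dot ω w' = 0 →
      eta n (fderiv ℝ (FLRWp1 n a) (t, χ, ω) (s, x, w))
            (fderiv ℝ (FLRWp1 n a) (t, χ, ω) (s', x', w'))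
        = (a t) ^ 2 * (s * s' - x * x' - (Real.sin χ) ^ 2 * dot w w') := by
  obtain ⟨m, rfl⟩ : ∃ m, n = m + 1 := ⟨n - 1, by omega⟩
  change Fin m → ℝ at ω
  change ∑ i : Fin m, (ω i) ^ 2 = 1 at hω
  constructor
  · have hS : ∑ i : Fin m, (a t * Real.sin χ * ω i) * (a t * Real.sin χ * ω i)
        = (a t * Real.sin χ) ^ 2 := by
      rw [← mul_one ((a t * Real.sin χ) ^ 2), ← hω, Finset.mul_sum]
      exact Finset.sum_congr rfl fun i _ => by ring
    unfold eta FLRWp1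
    rw [Fin.sum_univ_castSucc]
    simp
    rw [hS]
    linear_combination (a t) ^ 2 * Real.sin_sq_add_cos_sq t - (a t) ^ 2 * Real.sin_sq_add_cos_sq χ
  · intro s x w s' x' w' h h'
    change Fin m → ℝ at w
    change Fin m → ℝ at w'
    change ∑ i : Fin m, ω i * w i = 0 at h
    change ∑ i : Fin m, ω i * w' i = 0 at h'
    change _ = (a t) ^ 2 * (s * s' - x * x' - (Real.sin χ) ^ 2 * ∑ i : Fin m, w i * w' i)
    have hS : ∀ A B C : ℝ, ∑ i : Fin m, (A * ω i + C * w i) * (B * ω i + C * w' i)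
        = A * B + C ^ 2 * ∑ i : Fin m, w i * w' i := by
      intro A B C
      have : ∑ i : Fin m, (A * ω i + C * w i) * (B * ω i + C * w' i)
        = A * B * ∑ i : Fin m, ω i ^ 2 + A * C * ∑ i : Fin m, ω i * w' i
          + B * C * ∑ i : Fin m, ω i * w i + C ^ 2 * ∑ i : Fin m, w i * w' i := by
        simp only [Finset.mul_sum, ← Finset.sum_add_distrib]
        exact Finset.sum_congr rfl fun i _ => by ring
      rw [this, hω, h, h']; ring
    unfold eta
    simp only [FLRWp1_comp_aux _ a ha]
    rw [Fin.sum_univ_castSucc]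
    simp
    rw [hS]
    have p := Real.sin_sq_add_cos_sq t
    have q := Real.sin_sq_add_cos_sq χ
    linear_combination (deriv a t ^ 2 + a t ^ 2) * s * s' * p
      - (deriv a t ^ 2 * s * s' + a t ^ 2 * x * x') * q
end

section
/- Let n ≥ 1 and a : ℝ → ℝ. With Y the k = 0 FLRW embedding, for all ξ, ξ' : Fin n → ℝ: η(Y ξ, Y ξ') = -(1/2) * a (ξ 0) * a (ξ' 0) * q(ξ - ξ', ξ - ξ'). (Equation (YY_k0) of the paper: the ambient product of two embedded points of the spatially flat FLRW space equals minus one half the product of the scale factors times the Minkowski interval between the conformal coordinates; this expresses the massless conformally coupled scalar two-point function 1/(8π² y·y') in FLRW coordinates.) -/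
/-- Eq. (YY_k0): the ambient product of two embedded points of the spatially
flat FLRW space. -/
theorem stmt_6 (n : ℕ) (hn : 1 ≤ n) (a : ℝ → ℝ) (ξ ξ' : Fin n → ℝ) :
    eta n (FLRW0 n hn a ξ) (FLRW0 n hn a ξ')
      = -(1 / 2) * a (ξ ⟨0, hn⟩) * a (ξ' ⟨0, hn⟩) * qMink n hn (ξ - ξ') (ξ - ξ') := by
  obtain ⟨m, rfl⟩ : ∃ m, n = m + 1 := ⟨n - 1, by omega⟩
  have key : ∀ u v : Fin (m + 1) → ℝ,
      qMink (m + 1) hn u v = u 0 * v 0 - ∑ i : Fin m, u i.succ * v i.succ := fun u v => rfl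
  have hlt : ∀ (ζ : Fin (m + 1) → ℝ) (k : ℕ) (hk : k < m + 1) (hk' : k < m + 1 + 2),
      FLRW0 (m + 1) hn a ζ ⟨k, hk'⟩ = a (ζ 0) * ζ ⟨k, hk⟩ := by
    intro ζ k hk hk'
    simp only [FLRW0, hk, dif_pos]
    rfl
  have hmid : ∀ (ζ : Fin (m + 1) → ℝ) (hk' : m + 1 < m + 1 + 2),
      FLRW0 (m + 1) hn a ζ ⟨m + 1, hk'⟩
        = (1 / 2) * a (ζ 0) * (1 + qMink (m + 1) hn ζ ζ) := by
    intro ζ hk'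
    simp [FLRW0]
  have hlast : ∀ (ζ : Fin (m + 1) → ℝ) (hk' : m + 1 + 1 < m + 1 + 2),
      FLRW0 (m + 1) hn a ζ ⟨m + 1 + 1, hk'⟩
        = (1 / 2) * a (ζ 0) * (1 - qMink (m + 1) hn ζ ζ) := by
    intro ζ hk'
    simp [FLRW0]
  have h0 : ∀ ζ : Fin (m + 1) → ℝ, FLRW0 (m + 1) hn a ζ 0 = a (ζ 0) * ζ 0 :=
    fun ζ => hlt ζ 0 (by omega) (by omega)
  have hs : ∀ (ζ : Fin (m + 1) → ℝ) (i : Fin m) (hk' : i.val + 1 < m + 1 + 2),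
      FLRW0 (m + 1) hn a ζ ⟨i.val + 1, hk'⟩ = a (ζ 0) * ζ i.succ :=
    fun ζ i hk' => hlt ζ (i.val + 1) (by omega) hk'
  have hz : (⟨0, hn⟩ : Fin (m + 1)) = 0 := rfl
  have e1 : ∑ i : Fin m, (a (ξ 0) * ξ i.succ) * (a (ξ' 0) * ξ' i.succ)
      = a (ξ 0) * a (ξ' 0) * ∑ i : Fin m, ξ i.succ * ξ' i.succ := by
    rw [Finset.mul_sum]
    exact Finset.sum_congr rfl fun i _ => by ring
  have e2 : ∑ i : Fin m, (ξ i.succ - ξ' i.succ) * (ξ i.succ - ξ' i.succ)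
      = ∑ i : Fin m, ξ i.succ * ξ i.succ - 2 * ∑ i : Fin m, ξ i.succ * ξ' i.succ
        + ∑ i : Fin m, ξ' i.succ * ξ' i.succ := by
    rw [Finset.mul_sum, ← Finset.sum_sub_distrib, ← Finset.sum_add_distrib]
    exact Finset.sum_congr rfl fun i _ => by ring
  unfold eta
  rw [Fin.sum_univ_castSucc]
  simp only [Fin.val_castSucc, Fin.val_last, h0, hs, hmid, hlast, hz, e1, key, Pi.sub_apply, e2]
  ring
end

section
/- Let n ≥ 2 and a : ℝ → ℝ. With Y the k = -1 FLRW embedding, for all (t,χ,ω) and (t',χ',ω') in ℝ × ℝ × (Fin (n-1) → ℝ): η(Y(t,χ,ω), Y(t',χ',ω')) = a t * a t' * (cosh χ * cosh χ' - sinh χ * sinh χ' * (ω·ω') - cosh (t - t')). (Equation (YY_k1) of the paper, case k = -1: the ambient product of two embedded points of the open FLRW space, exhibiting the SO(1,n-1)-invariant product on the hyperboloid.) -/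
/-- Eq. (YY_k1), case k = -1: the ambient product of two embedded points of
the open FLRW space. -/
theorem stmt_7 (n : ℕ) (hn : 2 ≤ n) (a : ℝ → ℝ)
    (t χ : ℝ) (ω : Fin (n - 1) → ℝ) (t' χ' : ℝ) (ω' : Fin (n - 1) → ℝ) :
    eta n (FLRWm1 n a (t, χ, ω)) (FLRWm1 n a (t', χ', ω'))
      = a t * a t' * (Real.cosh χ * Real.cosh χ'
          - Real.sinh χ * Real.sinh χ' * dot ω ω' - Real.cosh (t - t')) := by
  obtain ⟨m, rfl⟩ : ∃ m, n = m + 1 := ⟨n - 1, by omega⟩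
  unfold eta dot
  rw [Fin.sum_univ_castSucc, Real.cosh_sub]
  have hs : ∀ i : Fin m,
      FLRWm1 (m + 1) a (t, χ, ω) ⟨(Fin.castSucc i).val + 1, by have := i.isLt; simp; omega⟩ *
      FLRWm1 (m + 1) a (t', χ', ω') ⟨(Fin.castSucc i).val + 1, by have := i.isLt; simp; omega⟩
      = (a t * Real.sinh χ * (a t' * Real.sinh χ')) * (ω i * ω' i) := by
    intro i
    simp [FLRWm1]
    ring
  rw [Finset.sum_congr rfl (fun i _ => hs i), ← Finset.mul_sum]
  change _ = a t * a t' * (Real.cosh χ * Real.cosh χ' - Real.sinh χ * Real.sinh χ' * (∑ i : Fin m, ω i * ω' i) - _)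
  generalize (∑ i : Fin m, ω i * ω' i) = S
  simp [FLRWm1]
  ring
end

section
/- Let n ≥ 2 and a : ℝ → ℝ. With Y the k = +1 FLRW embedding, for all (t,χ,ω) and (t',χ',ω') in ℝ × ℝ × (Fin (n-1) → ℝ): η(Y(t,χ,ω), Y(t',χ',ω')) = a t * a t' * (cos (t - t') - cos χ * cos χ' - sin χ * sin χ' * (ω·ω')). (Equation (YY_k1) of the paper, case k = +1: the ambient product of two embedded points of the closed FLRW space, exhibiting the SO(n)-invariant product on the sphere.) -/
/-- Eq. (YY_k1), case k = +1: the ambient product of two embedded points of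
the closed FLRW space. -/
theorem stmt_8 (n : ℕ) (hn : 2 ≤ n) (a : ℝ → ℝ)
    (t χ : ℝ) (ω : Fin (n - 1) → ℝ) (t' χ' : ℝ) (ω' : Fin (n - 1) → ℝ) :
    eta n (FLRWp1 n a (t, χ, ω)) (FLRWp1 n a (t', χ', ω'))
      = a t * a t' * (Real.cos (t - t')
          - Real.cos χ * Real.cos χ' - Real.sin χ * Real.sin χ' * dot ω ω') := by
  obtain ⟨m, rfl⟩ : ∃ m, n = m + 1 := ⟨n - 1, by omega⟩
  have hs : ∑ i : Fin (m + 1),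
      FLRWp1 (m + 1) a (t, χ, ω) ⟨i.val + 1, by have := i.isLt; omega⟩ *
        FLRWp1 (m + 1) a (t', χ', ω') ⟨i.val + 1, by have := i.isLt; omega⟩
      = a t * a t' * (Real.cos χ * Real.cos χ' + Real.sin χ * Real.sin χ' * dot ω ω') := by
    rw [Fin.sum_univ_castSucc]
    have h1 : ∀ i : Fin m,
        FLRWp1 (m + 1) a (t, χ, ω) ⟨i.castSucc.val + 1, by have := i.isLt; simp; omega⟩ *
          FLRWp1 (m + 1) a (t', χ', ω') ⟨i.castSucc.val + 1, by have := i.isLt; simp; omega⟩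
        = a t * a t' * (Real.sin χ * Real.sin χ') * (ω i * ω' i) := by
      intro i
      simp [FLRWp1]
      ring
    rw [Finset.sum_congr rfl (fun i _ => h1 i), ← Finset.mul_sum]
    have h2 : dot ω ω' = ∑ i : Fin m, ω i * ω' i := rfl
    rw [h2]
    simp [FLRWp1]
    ring
  unfold eta
  rw [hs, Real.cos_sub]
  simp [FLRWp1]
  ring
end

section
/- Let n ≥ 2 and define ψ : ℝ × ℝ × (Fin (n-1) → ℝ) → (Fin n → ℝ) by ψ(t,χ,ω) 0 = exp(-t) * cosh χ and ψ(t,χ,ω) i = exp(-t) * sinh χ * ω i for 1 ≤ i ≤ n-1. Then for every (t,χ,ω) with ∑_i (ω i)^2 = 1 and all tangent vectors (s,x,w), (s',x',w') with ω·w = 0 and ω·w' = 0: q((fderiv ℝ ψ (t,χ,ω)) (s,x,w), (fderiv ℝ ψ (t,χ,ω)) (s',x',w')) = exp(-2*t) * (s*s' - x*x' - (sinh χ)^2 * (w·w')). (Equation (Mink_k=-1) of the paper: the Minkowski metric takes the k = -1 FLRW form e^{-2t}[dt² - dχ² - sinh²χ · (metric of the unit (n-2)-sphere)] in these coordinates.)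 -/
/-- The coordinates `ψ(t,χ,ω) 0 = e^{-t} cosh χ`, `ψ(t,χ,ω) i = e^{-t} sinh χ * ω i`
(`1 ≤ i ≤ n-1`) on Minkowski space. -/
noncomputable def psiMap (n : ℕ) (p : ℝ × ℝ × (Fin (n - 1) → ℝ)) : Fin n → ℝ :=
  fun μ =>
    if h0 : (μ : ℕ) = 0 then Real.exp (-p.1) * Real.cosh p.2.1
    else Real.exp (-p.1) * Real.sinh p.2.1 * p.2.2 ⟨(μ : ℕ) - 1, by have := μ.isLt; omega⟩

theorem psi_fderiv (n : ℕ) (t χ : ℝ) (ω : Fin (n - 1) → ℝ) (s x : ℝ) (w : Fin (n - 1) → ℝ)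
    (μ : Fin n) :
    fderiv ℝ (psiMap n) (t, χ, ω) (s, x, w) μ =
      if h0 : (μ : ℕ) = 0 then Real.exp (-t) * (x * Real.sinh χ - s * Real.cosh χ)
      else Real.exp (-t) * ((x * Real.cosh χ - s * Real.sinh χ)
          * ω ⟨(μ : ℕ) - 1, by have := μ.isLt; omega⟩
        + Real.sinh χ * w ⟨(μ : ℕ) - 1, by have := μ.isLt; omega⟩) := by
  have hd : DifferentiableAt ℝ (psiMap n) (t, χ, ω) := by
    rw [differentiableAt_pi]
    intro i
    unfold psiMap
    by_cases h : (i : ℕ) = 0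
    · simp only [h, dite_true]
      fun_prop
    · simp only [h, dite_false]
      fun_prop
  have hl : HasDerivAt (fun τ : ℝ => (t + τ * s, χ + τ * x, ω + τ • w)) (s, x, w) 0 := by
    have h1 : HasDerivAt (fun τ : ℝ => t + τ * s) s 0 := by
      simpa using ((hasDerivAt_id (0:ℝ)).mul_const s).const_add t
    have h2 : HasDerivAt (fun τ : ℝ => χ + τ * x) x 0 := by
      simpa using ((hasDerivAt_id (0:ℝ)).mul_const x).const_add χ
    have h3 : HasDerivAt (fun τ : ℝ => ω + τ • w) w 0 := by
      simpa using ((hasDerivAt_id (0:ℝ)).smul_const w).const_add ω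
    exact h1.prodMk (h2.prodMk h3)
  have hc := HasFDerivAt.comp_hasDerivAt_of_eq (0:ℝ) hd.hasFDerivAt hl (by simp)
  have hμ := (hasDerivAt_pi.1 hc) μ
  refine hμ.unique ?_
  have h1 : HasDerivAt (fun τ : ℝ => t + τ * s) s 0 := by
    simpa using ((hasDerivAt_id (0:ℝ)).mul_const s).const_add t
  have h2 : HasDerivAt (fun τ : ℝ => χ + τ * x) x 0 := by
    simpa using ((hasDerivAt_id (0:ℝ)).mul_const x).const_add χ
  have he := h1.fun_neg.exp
  by_cases h : (μ : ℕ) = 0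
  · simp only [Function.comp_def, psiMap, h, dite_true]
    convert he.fun_mul h2.cosh using 1
    · rfl
    simp
    ring
  · simp only [Function.comp_def, psiMap, h, dite_false]
    generalize (⟨(μ : ℕ) - 1, _⟩ : Fin (n - 1)) = j
    have h3 : HasDerivAt (fun τ : ℝ => (ω + τ • w) j) (w j) 0 := by
      simpa using ((hasDerivAt_id (0:ℝ)).mul_const (w j)).const_add (ω j)
    convert (he.fun_mul h2.sinh).fun_mul h3 using 1
    · rfl
    simp
    ring

/-- Eq. (Mink_k=-1): the Minkowski metric takes the k = -1 FLRW form
`e^{-2t}[dt² - dχ² - sinh²χ · (metric of the unit (n-2)-sphere)]` in these coordinates. -/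
theorem stmt_9 (n : ℕ) (hn : 2 ≤ n)
    (t χ : ℝ) (ω : Fin (n - 1) → ℝ) (hω : ∑ i, (ω i) ^ 2 = 1)
    (s x : ℝ) (w : Fin (n - 1) → ℝ) (s' x' : ℝ) (w' : Fin (n - 1) → ℝ)
    (hw : dot ω w = 0) (hw' : dot ω w' = 0) :
    qMink n (by omega) (fderiv ℝ (psiMap n) (t, χ, ω) (s, x, w))
      (fderiv ℝ (psiMap n) (t, χ, ω) (s', x', w'))
      = Real.exp (-(2 * t)) * (s * s' - x * x' - (Real.sinh χ) ^ 2 * dot w w') := by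
  unfold dot at *
  simp only [qMink, psi_fderiv]
  simp only [dite_true, Nat.add_eq_zero_iff, one_ne_zero, and_false, dite_false,
    Nat.add_sub_cancel, Fin.eta]
  have key : ∀ E A B S : ℝ, ∑ i, (E * (A * ω i + S * w i)) * (E * (B * ω i + S * w' i))
      = E ^ 2 * (A * B * ∑ i, (ω i) ^ 2 + A * S * ∑ i, ω i * w' i + B * S * ∑ i, ω i * w i
        + S ^ 2 * ∑ i, w i * w' i) := by
    intro E A B S
    simp only [Finset.mul_sum, ← Finset.sum_add_distrib]
    exact Finset.sum_congr rfl fun i _ => by ring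
  rw [key, hω, hw, hw']
  have hE : Real.exp (-(2 * t)) = Real.exp (-t) ^ 2 := by
    rw [← Real.exp_nat_mul]
    congr 1
    push_cast
    ring
  rw [hE]
  have hcs := Real.cosh_sq χ
  linear_combination (Real.exp (-t) ^ 2 * (s * s' - x * x')) * hcs
end

section
/- Let n ≥ 2, let a : ℝ → ℝ, let t ∈ ℝ with 0 < a t and -π/2 < t < π/2, and let Y be the k = +1 FLRW embedding. Then at any point Y(t,χ,ω): (i) (Y(t,χ,ω) 0)^2 + (Y(t,χ,ω) (n+1))^2 = (a t)^2; (ii) Real.arctan (Y(t,χ,ω) (n+1) / Y(t,χ,ω) 0) = t; hence (iii) the k = +1 FLRW defining function evaluates to one: (a (Real.arctan (Y(t,χ,ω) (n+1) / Y(t,χ,ω) 0)))⁻¹ * Real.sqrt ((Y(t,χ,ω) 0)^2 + (Y(t,χ,ω) (n+1))^2) = 1. (Consistency of the defining function f_{k=+1} of Eq. (f_FLRW) with the embedding formulas of Property 4: the embedded k = +1 FLRW space lies on the hypersurface P_f = {f = 1}.) -/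
/-- Consistency of the defining function `f_{k=+1}` of Eq. (f_FLRW) with the
embedding formulas: the embedded k = +1 FLRW space lies on `{f = 1}`. -/
theorem stmt_14 (n : ℕ) (hn : 2 ≤ n) (a : ℝ → ℝ) (t : ℝ) (ht : 0 < a t)
    (ht1 : -(Real.pi / 2) < t) (ht2 : t < Real.pi / 2)
    (χ : ℝ) (ω : Fin (n - 1) → ℝ) :
    (FLRWp1 n a (t, χ, ω) 0) ^ 2
        + (FLRWp1 n a (t, χ, ω) ⟨n + 1, by omega⟩) ^ 2 = (a t) ^ 2 ∧
    Real.arctan (FLRWp1 n a (t, χ, ω) ⟨n + 1, by omega⟩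
        / FLRWp1 n a (t, χ, ω) 0) = t ∧
    (a (Real.arctan (FLRWp1 n a (t, χ, ω) ⟨n + 1, by omega⟩
          / FLRWp1 n a (t, χ, ω) 0)))⁻¹
      * Real.sqrt ((FLRWp1 n a (t, χ, ω) 0) ^ 2
          + (FLRWp1 n a (t, χ, ω) ⟨n + 1, by omega⟩) ^ 2) = 1 := by
  have h0 : FLRWp1 n a (t, χ, ω) 0 = a t * Real.cos t := by
    simp [FLRWp1]
  have h1 : FLRWp1 n a (t, χ, ω) ⟨n + 1, by omega⟩ = a t * Real.sin t := by
    simp [FLRWp1]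
  rw [h0, h1]
  have hs : (a t * Real.cos t) ^ 2 + (a t * Real.sin t) ^ 2 = (a t) ^ 2 := by
    linear_combination (a t) ^ 2 * Real.sin_sq_add_cos_sq t
  have hat : Real.arctan (a t * Real.sin t / (a t * Real.cos t)) = t := by
    rw [mul_div_mul_left _ _ ht.ne', ← Real.tan_eq_sin_div_cos, Real.arctan_tan ht1 ht2]
  refine ⟨hs, hat, ?_⟩
  rw [hs, hat, Real.sqrt_sq ht.le, inv_mul_cancel₀ ht.ne']
end
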